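/- (Theorem 1, uniqueness.) Let ν = e₃ and ℛ(ν) = {τ ∈ ℝ³ : ‖τ‖ = 1, τ·ν = 0} ∪ {ν}. Suppose (ω_m, ω′, h) and (ω_m*, ω′*, h*) are two triples, each consisting of a scalar, a traceless symmetric 3×3 matrix whose image of ν is parallel to ν (equivalently with vanishing 13 and 23 entries), and a traceless symmetric 3×3 matrix annihilating ν (hν = 0, h*ν = 0), such that for every n ∈ ℛ(ν): ω_m + nᵀω′n + (nᵀh n)² − (4/7)‖n‖² nᵀh²n + (2/35)tr(h²)‖n‖⁴ = ω_m* + nᵀω′*n + (nᵀh* n)² − (4/7)‖n‖² nᵀh*²n + (2/35)tr(h*²)‖n‖⁴. Then ω_m = ω_m*, ω′ = ω′*, and h* = h or h* = −h. -/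

import Mathlib

open Matrix

/-- The out-of-plane direction `ν = e₃`. -/
def nu3 : Fin 3 → ℝ := ![0, 0, 1]

/-- The representation `ω_m + nᵀω′n + (nᵀhn)² − (4/7)‖n‖²nᵀh²n + (2/35)tr(h²)‖n‖⁴`. -/
noncomputable def crackDensity4 (ωm : ℝ) (ω' h : Matrix (Fin 3) (Fin 3) ℝ)
    (n : Fin 3 → ℝ) : ℝ :=
  ωm + n ⬝ᵥ ω'.mulVec n + (n ⬝ᵥ h.mulVec n) ^ 2
    - 4 / 7 * (∑ i, n i ^ 2) * (n ⬝ᵥ (h * h).mulVec n)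
    + 2 / 35 * (h * h).trace * (∑ i, n i ^ 2) ^ 2

/-- A traceless symmetric matrix annihilating `e₃` is a planar deviator. -/
lemma eq_planar_deviator {h : Matrix (Fin 3) (Fin 3) ℝ} (hs : h.IsSymm) (ht : h.trace = 0)
    (hν : h.mulVec nu3 = 0) :
    h = !![h 0 0, h 0 1, 0; h 0 1, -h 0 0, 0; 0, 0, 0] := by
  have h02 : h 0 2 = 0 := by simpa [nu3, mulVec, dotProduct, Fin.sum_univ_three] using congrFun hν 0
  have h12 : h 1 2 = 0 := by simpa [nu3, mulVec, dotProduct, Fin.sum_univ_three] using congrFun hν 1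
  have h22 : h 2 2 = 0 := by simpa [nu3, mulVec, dotProduct, Fin.sum_univ_three] using congrFun hν 2
  have h10 := hs.apply 0 1
  have h20 := hs.apply 0 2
  have h21 := hs.apply 1 2
  have h11 : h 1 1 = -h 0 0 := by
    rw [trace_fin_three] at ht
    linarith
  ext i j
  fin_cases i <;> fin_cases j <;> simp <;> linarith

/-- A traceless symmetric matrix with vanishing 13 and 23 entries is determined by its 11, 22
and 12 entries. -/
lemma eq_block_of_traceless {w : Matrix (Fin 3) (Fin 3) ℝ} (hs : w.IsSymm) (ht : w.trace = 0)
    (h02 : w 0 2 = 0) (h12 : w 1 2 = 0) :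
    w = !![w 0 0, w 0 1, 0; w 0 1, w 1 1, 0; 0, 0, -w 0 0 - w 1 1] := by
  have h10 := hs.apply 0 1
  have h20 := hs.apply 0 2
  have h21 := hs.apply 1 2
  rw [trace_fin_three] at ht
  ext i j
  fin_cases i <;> fin_cases j <;> simp <;> linarith

/-- The density of a triple in normal form, as a polynomial in the coordinates of the direction. -/
lemma crackDensity4_planar (m p q s a b x y z : ℝ) :
    crackDensity4 m !![p, s, 0; s, q, 0; 0, 0, -p - q] !![a, b, 0; b, -a, 0; 0, 0, 0] ![x, y, z] =
      m + (p * x ^ 2 + 2 * s * x * y + q * y ^ 2 - (p + q) * z ^ 2)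
        + (a * (x ^ 2 - y ^ 2) + 2 * b * x * y) ^ 2
        - 4 / 7 * (x ^ 2 + y ^ 2 + z ^ 2) * ((a ^ 2 + b ^ 2) * (x ^ 2 + y ^ 2))
        + 4 / 35 * (a ^ 2 + b ^ 2) * (x ^ 2 + y ^ 2 + z ^ 2) ^ 2 := by
  simp [crackDensity4, mulVec, dotProduct, Fin.sum_univ_three, trace_fin_three, Matrix.mul_apply]
  ring

/-- Complex square roots are unique up to sign, in real coordinates. -/
lemma eq_or_eq_neg_of_complex_sq_eq {a b c d : ℝ} (hre : c ^ 2 - d ^ 2 = a ^ 2 - b ^ 2)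
    (him : c * d = a * b) : (c = a ∧ d = b) ∨ (c = -a ∧ d = -b) := by
  have h : (⟨c, d⟩ : ℂ) ^ 2 = (⟨a, b⟩ : ℂ) ^ 2 := by
    apply Complex.ext <;> simp [pow_two] <;> linarith
  simpa [Complex.ext_iff] using sq_eq_sq_iff_eq_or_eq_neg.1 h

/-- **Theorem 1 (uniqueness).** Two triples `(ω_m, ω′, h)` and `(ω_m*, ω′*, h*)`, made of a
scalar, a traceless symmetric matrix with `ω′ν ∥ ν` (i.e. vanishing 13 and 23 entries) and a
traceless symmetric matrix annihilating `ν = e₃`, which represent the same density function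
over the mechanically accessible directions `ℛ(ν)`, coincide up to the sign of `h`. -/
theorem theorem1_uniqueness
    (ωm ωms : ℝ) (ω' h ω's hs : Matrix (Fin 3) (Fin 3) ℝ)
    (hω'1 : ω'.IsSymm) (hω'2 : ω'.trace = 0) (hω'3 : ω' 0 2 = 0) (hω'4 : ω' 1 2 = 0)
    (hh1 : h.IsSymm) (hh2 : h.trace = 0) (hh3 : h.mulVec nu3 = 0)
    (hω's1 : ω's.IsSymm) (hω's2 : ω's.trace = 0) (hω's3 : ω's 0 2 = 0) (hω's4 : ω's 1 2 = 0)
    (hhs1 : hs.IsSymm) (hhs2 : hs.trace = 0) (hhs3 : hs.mulVec nu3 = 0)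
    (heq : ∀ n : Fin 3 → ℝ, ((∑ i, n i ^ 2 = 1 ∧ n ⬝ᵥ nu3 = 0) ∨ n = nu3) →
      crackDensity4 ωm ω' h n = crackDensity4 ωms ω's hs n) :
    ωm = ωms ∧ ω' = ω's ∧ (hs = h ∨ hs = -h) := by
  rw [eq_block_of_traceless hω'1 hω'2 hω'3 hω'4, eq_planar_deviator hh1 hh2 hh3,
    eq_block_of_traceless hω's1 hω's2 hω's3 hω's4, eq_planar_deviator hhs1 hhs2 hhs3] at heq ⊢
  generalize ω' 0 0 = p, ω' 1 1 = q, ω' 0 1 = s, h 0 0 = a, h 0 1 = b,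
    ω's 0 0 = p', ω's 1 1 = q', ω's 0 1 = s', hs 0 0 = c, hs 0 1 = d at heq ⊢
  have plane (x y : ℝ) (hxy : x ^ 2 + y ^ 2 = 1) :=
    heq ![x, y, 0] (Or.inl ⟨by simpa [Fin.sum_univ_three] using hxy,
      by simp [nu3, dotProduct, Fin.sum_univ_three]⟩)
  have e3 := heq ![0, 0, 1] (Or.inr rfl)
  have e1 := plane 1 0 (by norm_num)
  have e2 := plane 0 1 (by norm_num)
  have e4 := plane (3 / 5) (4 / 5) (by norm_num)
  have e5 := plane (3 / 5) (-4 / 5) (by norm_num)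
  have e6 := plane (4 / 5) (3 / 5) (by norm_num)
  have e7 := plane (4 / 5) (-3 / 5) (by norm_num)
  simp only [crackDensity4_planar] at e1 e2 e3 e4 e5 e6 e7
  ring_nf at e1 e2 e3 e4 e5 e6 e7
  have hs : s = s' := by linarith
  have hre : c ^ 2 - d ^ 2 = a ^ 2 - b ^ 2 := by linarith
  have him : c * d = a * b := by linarith
  have hsign := eq_or_eq_neg_of_complex_sq_eq hre him
  have ha : c ^ 2 = a ^ 2 := by rcases hsign with ⟨rfl, _⟩ | ⟨rfl, _⟩ <;> ring
  have hm : ωm = ωms := by linarith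
  have hp : p = p' := by linarith
  have hq : q = q' := by linarith
  refine ⟨hm, by rw [hp, hq, hs], ?_⟩
  rcases hsign with ⟨rfl, rfl⟩ | ⟨rfl, rfl⟩
  · exact Or.inl rfl
  · right
    ext i j
    fin_cases i <;> fin_cases j <;> simp
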